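/- arXiv:2103.01156 — 8 statements merged into one kernel-verified Lean document; each statement's English description precedes it below -/
import Mathlib

section
/- Let C be a category with an initial object and binary coproducts. Let R be a class of morphisms of C that is closed under retracts in the arrow category, right-saturated, and has enough projectives. Let L be the class of morphisms that are retracts, in the arrow category, of a coproduct inclusion inl : X → X ⨿ P with P projective with respect to R. Then (L, R) is a weak factorization system on C: every morphism in L has the left lifting property with respect to every morphism in R, every morphism of C factors as a morphism in L followed by a morphism in R, L is exactly the class of morphisms with the left lifting property with respect to all of R, and R is exactly the class of morphisms with the right lifting property with respect to all of L. Moreover, R is exactly the class of morphisms having the right lifting property with respect to all morphisms of the form (initial object) → P with P projective with respect to R. -/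
open CategoryTheory Limits

universe v u

namespace Stmt0

variable {C : Type u} [Category.{v} C]

/-- `f` is a retract of `g` in the arrow category. -/
def RetractArrow {A B X Y : C} (f : A ⟶ B) (g : X ⟶ Y) : Prop :=
  ∃ (i : Arrow.mk f ⟶ Arrow.mk g) (r : Arrow.mk g ⟶ Arrow.mk f), i ≫ r = 𝟙 (Arrow.mk f)

/-- `P` is projective with respect to the class of morphisms `R`. -/
def ProjectiveWrt (R : MorphismProperty C) (P : C) : Prop :=
  ∀ ⦃A B : C⦄ (ρ : A ⟶ B), R ρ → ∀ u : P ⟶ B, ∃ v : P ⟶ A, v ≫ ρ = u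

/-- `R` has enough projectives. -/
def EnoughProjectivesWrt (R : MorphismProperty C) : Prop :=
  ∀ X : C, ∃ (P : C) (ρ : P ⟶ X), R ρ ∧ ProjectiveWrt R P

/-- `(L, R)` is a weak factorization system: liftings, factorizations, and each class is
determined by the lifting property against the other. -/
def IsWFS (L R : MorphismProperty C) : Prop :=
  (∀ ⦃A B X Y : C⦄ (l : A ⟶ B) (r : X ⟶ Y), L l → R r → HasLiftingProperty l r) ∧
  (∀ ⦃X Y : C⦄ (f : X ⟶ Y), ∃ (Z : C) (l : X ⟶ Z) (r : Z ⟶ Y), L l ∧ R r ∧ l ≫ r = f) ∧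
  (∀ ⦃A B : C⦄ (l : A ⟶ B), L l ↔ ∀ ⦃X Y : C⦄ (r : X ⟶ Y), R r → HasLiftingProperty l r) ∧
  (∀ ⦃X Y : C⦄ (r : X ⟶ Y), R r ↔ ∀ ⦃A B : C⦄ (l : A ⟶ B), L l → HasLiftingProperty l r)

/-- The class of retracts (in the arrow category) of coproduct inclusions
`inl : X ⟶ X ⨿ P` with `P` projective with respect to `R`. -/
def leftClass [HasBinaryCoproducts C] (R : MorphismProperty C) : MorphismProperty C :=
  fun _ _ f => ∃ (X P : C), ProjectiveWrt R P ∧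
    RetractArrow f (coprod.inl : X ⟶ X ⨿ P)

lemma RetractArrow.of_comm {A B X Y : C} {f : A ⟶ B} {g : X ⟶ Y} (i₁ : A ⟶ X) (i₂ : B ⟶ Y)
    (r₁ : X ⟶ A) (r₂ : Y ⟶ B) (hi : i₁ ≫ g = f ≫ i₂) (hr : r₁ ≫ f = g ≫ r₂)
    (h₁ : i₁ ≫ r₁ = 𝟙 A) (h₂ : i₂ ≫ r₂ = 𝟙 B) : RetractArrow f g :=
  ⟨Arrow.homMk i₁ i₂ hi, Arrow.homMk r₁ r₂ hr, Arrow.hom_ext _ _ h₁ h₂⟩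

lemma RetractArrow.hasLiftingProperty {A B X Y Z W : C} {f : A ⟶ B} {g : X ⟶ Y}
    (h : RetractArrow f g) (p : Z ⟶ W) (hg : HasLiftingProperty g p) :
    HasLiftingProperty f p := by
  obtain ⟨i, r, hir⟩ := h
  exact CategoryTheory.RetractArrow.leftLiftingProperty ⟨i, r, hir⟩ p

lemma ProjectiveWrt.hasLiftingProperty_inl [HasBinaryCoproducts C] {R : MorphismProperty C}
    {P : C} (hP : ProjectiveWrt R P) (X : C) {A B : C} {p : A ⟶ B} (hp : R p) :
    HasLiftingProperty (coprod.inl : X ⟶ X ⨿ P) p where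
  sq_hasLift {f g} sq := by
    obtain ⟨v, hv⟩ := hP p hp (coprod.inr ≫ g)
    exact ⟨⟨{ l := coprod.desc f v
              fac_left := coprod.inl_desc f v
              fac_right := by ext <;> simp [hv, sq.w, coprod.inl_desc, coprod.inr_desc] }⟩⟩

lemma leftClass_inl [HasBinaryCoproducts C] {R : MorphismProperty C} (X : C) {P : C}
    (hP : ProjectiveWrt R P) : leftClass R (coprod.inl : X ⟶ X ⨿ P) :=
  ⟨X, P, hP, RetractArrow.of_comm (𝟙 _) (𝟙 _) (𝟙 _) (𝟙 _)
    (by simp) (by simp) (by simp) (by simp)⟩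

lemma leftClass_initial_to [HasInitial C] [HasBinaryCoproducts C] {R : MorphismProperty C}
    {P : C} (hP : ProjectiveWrt R P) : leftClass R (initial.to P) :=
  ⟨⊥_ C, P, hP, RetractArrow.of_comm (𝟙 _) coprod.inr (𝟙 _) (coprod.desc (initial.to P) (𝟙 P))
    (Subsingleton.elim _ _) (Subsingleton.elim _ _) (by simp) (by simp [coprod.inr_desc])⟩

lemma leftClass_hasLiftingProperty [HasBinaryCoproducts C] {R : MorphismProperty C}
    {A B X Y : C} {l : A ⟶ B} {r : X ⟶ Y} (hl : leftClass R l) (hr : R r) :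
    HasLiftingProperty l r := by
  obtain ⟨Z, P, hP, h⟩ := hl
  exact h.hasLiftingProperty r (hP.hasLiftingProperty_inl Z hr)

theorem stmt0 [HasInitial C] [HasBinaryCoproducts C] (R : MorphismProperty C)
    (hretract : ∀ ⦃A B X Y : C⦄ (f : A ⟶ B) (g : X ⟶ Y), RetractArrow f g → R g → R f)
    (hsat : ∀ ⦃X Y Z : C⦄ (f : X ⟶ Z) (g : Y ⟶ Z), R f → R (coprod.desc f g))
    (hproj : EnoughProjectivesWrt R) :
    IsWFS (leftClass R) R ∧
      (∀ ⦃X Y : C⦄ (r : X ⟶ Y), R r ↔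
        ∀ (P : C), ProjectiveWrt R P → HasLiftingProperty (initial.to P) r) := by
  have desc_mem : ∀ ⦃X P Y : C⦄ (f : X ⟶ Y) (ρ : P ⟶ Y), R ρ → R (coprod.desc f ρ) :=
    fun X P Y f ρ hρ ↦ hretract _ (coprod.desc ρ f)
      (RetractArrow.of_comm (coprod.braiding X P).hom (𝟙 Y) (coprod.braiding X P).inv (𝟙 Y)
        (by ext <;> simp [coprod.inl_desc, coprod.inr_desc])
        (by ext <;> simp [coprod.inl_desc, coprod.inr_desc])
        (by simp [coprod.inl_desc, coprod.inr_desc]) (by simp)) (hsat ρ f hρ)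
  have mem_of_initial : ∀ ⦃X Y : C⦄ (r : X ⟶ Y),
      (∀ P : C, ProjectiveWrt R P → HasLiftingProperty (initial.to P) r) → R r := by
    intro X Y r h
    obtain ⟨P, ρ, hρ, hP⟩ := hproj Y
    have := h P hP
    have sq : CommSq (initial.to X) (initial.to P) r ρ := ⟨Subsingleton.elim _ _⟩
    exact hretract r (coprod.desc ρ r)
      (RetractArrow.of_comm coprod.inr (𝟙 Y) (coprod.desc sq.lift (𝟙 X)) (𝟙 Y)
        (by simp [coprod.inr_desc]) (by ext <;> simp [coprod.inl_desc, coprod.inr_desc])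
        (by simp [coprod.inr_desc]) (by simp)) (hsat ρ r hρ)
  refine ⟨⟨fun A B X Y l r hl hr ↦ leftClass_hasLiftingProperty hl hr, ?_, ?_, ?_⟩, ?_⟩
  · intro X Y f
    obtain ⟨P, ρ, hρ, hP⟩ := hproj Y
    exact ⟨_, coprod.inl, coprod.desc f ρ, leftClass_inl X hP, desc_mem f ρ hρ,
      coprod.inl_desc f ρ⟩
  · refine fun A B l ↦ ⟨fun hl X Y r hr ↦ leftClass_hasLiftingProperty hl hr, fun h ↦ ?_⟩
    obtain ⟨P, ρ, hρ, hP⟩ := hproj B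
    have := h _ (desc_mem l ρ hρ)
    have sq : CommSq coprod.inl l (coprod.desc l ρ) (𝟙 B) := ⟨by simp [coprod.inl_desc]⟩
    exact ⟨A, P, hP, RetractArrow.of_comm (𝟙 A) sq.lift (𝟙 A) (coprod.desc l ρ)
      (by simp) (by simp [coprod.inl_desc]) (by simp) (by simp)⟩
  · exact fun X Y r ↦ ⟨fun hr A B l hl ↦ leftClass_hasLiftingProperty hl hr,
      fun h ↦ mem_of_initial r fun P hP ↦ h _ (leftClass_initial_to hP)⟩
  · exact fun X Y r ↦ ⟨fun hr P hP ↦ leftClass_hasLiftingProperty (leftClass_initial_to hP) hr,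
      mem_of_initial r⟩

end Stmt0
end

section
/- Let C be a finitary extensive category. If a morphism f : A → C is a retract in the arrow category of a coproduct inclusion inl : B → B ⨿ E, then f is itself isomorphic in the arrow category to a coproduct inclusion; that is, there exists an object Y of C and an isomorphism of arrows between f : A → C and the coproduct inclusion inl : A → A ⨿ Y. -/
open CategoryTheory Limits

universe v u

namespace Stmt2

variable {C : Type u} [Category.{v} C]

/-- `f` is a retract of `g` in the arrow category. -/
def RetractArrow {A B X Y : C} (f : A ⟶ B) (g : X ⟶ Y) : Prop :=
  ∃ (i : Arrow.mk f ⟶ Arrow.mk g) (r : Arrow.mk g ⟶ Arrow.mk f), i ≫ r = 𝟙 (Arrow.mk f)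

/-- The section square of a retract of a monomorphism is a pullback square. -/
theorem isPullback_of_retract_mono {A B X Y : C} {f : A ⟶ X} {g : B ⟶ Y} [Mono g]
    {i : A ⟶ B} {j : X ⟶ Y} {p : B ⟶ A} {q : Y ⟶ X} (hi : i ≫ g = f ≫ j) (hp : p ≫ f = g ≫ q)
    (hip : i ≫ p = 𝟙 A) (hjq : j ≫ q = 𝟙 X) : IsPullback f i j g := by
  refine ⟨⟨hi.symm⟩, ⟨PullbackCone.IsLimit.mk _ (fun s ↦ s.snd ≫ p) (fun s ↦ ?_) (fun s ↦ ?_)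
    (fun s m _ hm ↦ ?_)⟩⟩
  · rw [Category.assoc, hp, ← s.condition_assoc, hjq, Category.comp_id]
  · rw [← cancel_mono g, Category.assoc, Category.assoc, hi, reassoc_of% hp,
      ← s.condition_assoc, reassoc_of% hjq, s.condition]
  · rw [← hm, Category.assoc, hip, Category.comp_id]

/-- In a finitary extensive category, the pullback of a coproduct inclusion is a coproduct
inclusion. -/
theorem exists_isColimit_of_isPullback_inl [FinitaryExtensive C] {A B E X : C} {f : A ⟶ X}
    {i : A ⟶ B} {j : X ⟶ B ⨿ E} (h : IsPullback f i j coprod.inl) :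
    ∃ (Y : C) (k : Y ⟶ X), Nonempty (IsColimit (BinaryCofan.mk f k)) := by
  have : HasPullback j (coprod.inr : E ⟶ B ⨿ E) :=
    HasPullbacksOfInclusions.hasPullbackInr' j
  have hE := IsPullback.of_hasPullback j (coprod.inr : E ⟶ B ⨿ E)
  exact ⟨_, _, ((BinaryCofan.isVanKampen_iff _).mp
    (FinitaryExtensive.van_kampen' _ (coprodIsCoprod B E)) (BinaryCofan.mk f _) i _ j
    h.w.symm hE.w.symm).mpr ⟨h, hE⟩⟩

theorem stmt2 [FinitaryExtensive C] {A C' B E : C} (f : A ⟶ C')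
    (h : RetractArrow f (coprod.inl : B ⟶ B ⨿ E)) :
    ∃ (Y : C), Nonempty (Arrow.mk f ≅ Arrow.mk (coprod.inl : A ⟶ A ⨿ Y)) := by
  obtain ⟨i, r, hir⟩ := h
  have : Mono (coprod.inl : B ⟶ B ⨿ E) :=
    FinitaryExtensive.mono_inl_of_isColimit (c := BinaryCofan.mk coprod.inl coprod.inr)
      (coprodIsCoprod B E)
  obtain ⟨Y, k, ⟨hk⟩⟩ := exists_isColimit_of_isPullback_inl
    (isPullback_of_retract_mono (f := f) (Arrow.w i) (Arrow.w r)
      (congrArg CommaMorphism.left hir) (congrArg CommaMorphism.right hir))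
  have hc : IsColimit (BinaryCofan.mk (coprod.inl : A ⟶ A ⨿ Y) coprod.inr) := coprodIsCoprod A Y
  let e := hk.coconePointUniqueUpToIso hc
  have he : f ≫ e.hom = coprod.inl := hk.comp_coconePointUniqueUpToIso_hom hc ⟨.left⟩
  exact ⟨Y, ⟨Arrow.isoMk (Iso.refl _) e ((Category.id_comp _).trans he.symm)⟩⟩

end Stmt2
end

section
/- Let C be a category with finite coproducts and pullbacks, such that the class of effective epimorphisms has enough projectives. Let R be the class of effective epimorphisms of C, and let L be the class of morphisms that are retracts in the arrow category of a coproduct inclusion inl : X → X ⨿ P with P projective with respect to effective epimorphisms. Then (L, R) is a weak factorization system on C. Moreover, a morphism of C is an effective epimorphism if and only if it has the right lifting property with respect to all morphisms of the form (initial object) → P with P projective with respect to effective epimorphisms. -/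
open CategoryTheory Limits

universe v u

namespace Stmt4

variable {C : Type u} [Category.{v} C]

/-- `f` is a retract of `g` in the arrow category. -/
def RetractArrow {A B X Y : C} (f : A ⟶ B) (g : X ⟶ Y) : Prop :=
  ∃ (i : Arrow.mk f ⟶ Arrow.mk g) (r : Arrow.mk g ⟶ Arrow.mk f), i ≫ r = 𝟙 (Arrow.mk f)

/-- `P` is projective with respect to the class of morphisms `R`. -/
def ProjectiveWrt (R : MorphismProperty C) (P : C) : Prop :=
  ∀ ⦃A B : C⦄ (ρ : A ⟶ B), R ρ → ∀ u : P ⟶ B, ∃ v : P ⟶ A, v ≫ ρ = u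

/-- `R` has enough projectives. -/
def EnoughProjectivesWrt (R : MorphismProperty C) : Prop :=
  ∀ X : C, ∃ (P : C) (ρ : P ⟶ X), R ρ ∧ ProjectiveWrt R P

/-- `(L, R)` is a weak factorization system. -/
def IsWFS (L R : MorphismProperty C) : Prop :=
  (∀ ⦃A B X Y : C⦄ (l : A ⟶ B) (r : X ⟶ Y), L l → R r → HasLiftingProperty l r) ∧
  (∀ ⦃X Y : C⦄ (f : X ⟶ Y), ∃ (Z : C) (l : X ⟶ Z) (r : Z ⟶ Y), L l ∧ R r ∧ l ≫ r = f) ∧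
  (∀ ⦃A B : C⦄ (l : A ⟶ B), L l ↔ ∀ ⦃X Y : C⦄ (r : X ⟶ Y), R r → HasLiftingProperty l r) ∧
  (∀ ⦃X Y : C⦄ (r : X ⟶ Y), R r ↔ ∀ ⦃A B : C⦄ (l : A ⟶ B), L l → HasLiftingProperty l r)

/-- The class of effective epimorphisms. -/
def effEpis (C : Type u) [Category.{v} C] : MorphismProperty C :=
  fun _ _ f => EffectiveEpi f

/-- The class of retracts (in the arrow category) of coproduct inclusions
`inl : X ⟶ X ⨿ P` with `P` projective with respect to effective epimorphisms. -/
def effProjL [HasBinaryCoproducts C] : MorphismProperty C :=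
  fun _ _ f => ∃ (X P : C), ProjectiveWrt (effEpis C) P ∧
    RetractArrow f (coprod.inl : X ⟶ X ⨿ P)

lemma RetractArrow.hasLiftingProperty {A B X Y : C} {f : A ⟶ B} {g : X ⟶ Y}
    (h : RetractArrow f g) {Z W : C} (p : Z ⟶ W) [HasLiftingProperty g p] :
    HasLiftingProperty f p := by
  obtain ⟨i, r, hir⟩ := h
  exact CategoryTheory.RetractArrow.leftLiftingProperty ⟨i, r, hir⟩ p

/-- A morphism through which every morphism from a projective object to its target factors is an
effective epimorphism. -/
lemma effectiveEpi_of_forall_projective_lift (hproj : EnoughProjectivesWrt (effEpis C))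
    {X Y : C} (f : X ⟶ Y)
    (hf : ∀ (P : C), ProjectiveWrt (effEpis C) P → ∀ u : P ⟶ Y, ∃ v : P ⟶ X, v ≫ f = u) :
    EffectiveEpi f := by
  obtain ⟨P, ρ, hρ, hP⟩ := hproj Y
  obtain ⟨Q, q, hq, hQ⟩ := hproj X
  have : EffectiveEpi ρ := hρ
  have : EffectiveEpi q := hq
  obtain ⟨s, hs⟩ := hf P hP ρ
  obtain ⟨t, ht⟩ := hQ ρ hρ (q ≫ f)
  have : Epi f := epi_of_epi_fac hs
  have coeq {W : C} (e : X ⟶ W)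
      (h : ∀ {Z : C} (g₁ g₂ : Z ⟶ X), g₁ ≫ f = g₂ ≫ f → g₁ ≫ e = g₂ ≫ e)
      {Z : C} (g₁ g₂ : Z ⟶ P) (hg : g₁ ≫ ρ = g₂ ≫ ρ) : g₁ ≫ s ≫ e = g₂ ≫ s ≫ e := by
    simpa using h (g₁ ≫ s) (g₂ ≫ s) (by simpa [hs] using hg)
  have fac {W : C} (e : X ⟶ W)
      (h : ∀ {Z : C} (g₁ g₂ : Z ⟶ X), g₁ ≫ f = g₂ ≫ f → g₁ ≫ e = g₂ ≫ e) :
      f ≫ EffectiveEpi.desc ρ (s ≫ e) (coeq e h) = e := by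
    rw [← cancel_epi q, ← Category.assoc, ← ht, Category.assoc, EffectiveEpi.fac]
    simpa using h (t ≫ s) q (by simp [hs, ht])
  exact ⟨⟨{
    desc e h := EffectiveEpi.desc ρ (s ≫ e) (coeq e h)
    fac := fac
    uniq e h m hm := by rw [← cancel_epi f, hm, fac e h] }⟩⟩

lemma hasLiftingProperty_coprod_inl [HasBinaryCoproducts C] {P : C}
    (hP : ProjectiveWrt (effEpis C) P) (A : C) {X Y : C} (r : X ⟶ Y) (hr : EffectiveEpi r) :
    HasLiftingProperty (coprod.inl : A ⟶ A ⨿ P) r where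
  sq_hasLift {u w} sq := by
    obtain ⟨v, hv⟩ := hP r hr (coprod.inr ≫ w)
    exact ⟨⟨{ l := coprod.desc u v
              fac_left := coprod.inl_desc u v
              fac_right := coprod.hom_ext
                (by rw [← Category.assoc, coprod.inl_desc, sq.w])
                (by rw [← Category.assoc, coprod.inr_desc, hv]) }⟩⟩

lemma effProjL_coprod_inl [HasBinaryCoproducts C] {P : C} (hP : ProjectiveWrt (effEpis C) P)
    (X : C) : effProjL (coprod.inl : X ⟶ X ⨿ P) :=
  ⟨X, P, hP, 𝟙 _, 𝟙 _, Category.comp_id _⟩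

lemma effProjL.hasLiftingProperty [HasBinaryCoproducts C] {A B X Y : C} {l : A ⟶ B}
    (hl : effProjL l) (r : X ⟶ Y) (hr : EffectiveEpi r) : HasLiftingProperty l r := by
  obtain ⟨A, P, hP, h⟩ := hl
  have := hasLiftingProperty_coprod_inl hP A r hr
  exact h.hasLiftingProperty r

/-- Every morphism factors as a coproduct inclusion with projective complement followed by an
effective epimorphism. -/
lemma exists_coprod_inl_effectiveEpi_fac [HasBinaryCoproducts C]
    (hproj : EnoughProjectivesWrt (effEpis C)) {X Y : C} (f : X ⟶ Y) :
    ∃ (P : C) (r : X ⨿ P ⟶ Y), ProjectiveWrt (effEpis C) P ∧ EffectiveEpi r ∧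
      coprod.inl ≫ r = f := by
  obtain ⟨P, ρ, hρ, hP⟩ := hproj Y
  refine ⟨P, coprod.desc f ρ, hP, effectiveEpi_of_forall_projective_lift hproj _ fun Q hQ u ↦ ?_,
    coprod.inl_desc f ρ⟩
  obtain ⟨v, hv⟩ := hQ ρ hρ u
  exact ⟨v ≫ coprod.inr, by rw [Category.assoc, coprod.inr_desc, hv]⟩

/-- The retract argument. -/
lemma effProjL_of_hasLiftingProperty [HasBinaryCoproducts C]
    (hproj : EnoughProjectivesWrt (effEpis C)) {A B : C} (l : A ⟶ B)
    (hl : ∀ ⦃X Y : C⦄ (r : X ⟶ Y), EffectiveEpi r → HasLiftingProperty l r) : effProjL l := by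
  obtain ⟨P, r, hP, hr, fac⟩ := exists_coprod_inl_effectiveEpi_fac hproj l
  have := hl r hr
  let h := CategoryTheory.RetractArrow.ofLeftLiftingProperty fac
  exact ⟨A, P, hP, h.i, h.r, h.retract⟩

theorem stmt4 [HasFiniteCoproducts C] [HasPullbacks C]
    (hproj : EnoughProjectivesWrt (effEpis C)) :
    IsWFS (effProjL (C := C)) (effEpis C) ∧
      (∀ ⦃X Y : C⦄ (r : X ⟶ Y), EffectiveEpi r ↔
        ∀ (P : C), ProjectiveWrt (effEpis C) P → HasLiftingProperty (initial.to P) r) := by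
  refine ⟨⟨fun _ _ _ _ l r hl hr ↦ hl.hasLiftingProperty r hr, fun X Y f ↦ ?_, fun A B l ↦
    ⟨fun hl X Y r hr ↦ hl.hasLiftingProperty r hr, effProjL_of_hasLiftingProperty hproj l⟩,
    fun X Y r ↦ ⟨fun hr A B l hl ↦ hl.hasLiftingProperty r hr, fun h ↦ ?_⟩⟩,
    fun X Y r ↦ ⟨fun hr P hP ↦ ⟨fun {u w} sq ↦ ?_⟩, fun h ↦ ?_⟩⟩
  · obtain ⟨P, r, hP, hr, fac⟩ := exists_coprod_inl_effectiveEpi_fac hproj f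
    exact ⟨_, coprod.inl, r, effProjL_coprod_inl hP X, hr, fac⟩
  · refine effectiveEpi_of_forall_projective_lift hproj r fun P hP u ↦ ?_
    have := h _ (effProjL_coprod_inl hP (⊥_ C))
    have sq : CommSq (initial.to X) (coprod.inl : ⊥_ C ⟶ (⊥_ C) ⨿ P) r
        (coprod.desc (initial.to Y) u) := ⟨Subsingleton.elim _ _⟩
    exact ⟨coprod.inr ≫ sq.lift, by rw [Category.assoc, sq.fac_right, coprod.inr_desc]⟩
  · obtain ⟨v, hv⟩ := hP r hr w
    exact ⟨⟨{ l := v, fac_left := Subsingleton.elim _ _, fac_right := hv }⟩⟩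
  · refine effectiveEpi_of_forall_projective_lift hproj r fun P hP u ↦ ?_
    have := h P hP
    have sq : CommSq (initial.to X) (initial.to P) r u := ⟨Subsingleton.elim _ _⟩
    exact ⟨sq.lift, sq.fac_right⟩

end Stmt4
end

section
/- Let C be a category with pullbacks such that the class of effective epimorphisms has enough projectives. Let f : X → Y be an effective epimorphism and g : Z → Y any morphism. Then the pullback projection X ×_Y Z → Z is an epimorphism. -/
open CategoryTheory Limits

universe v u

namespace Stmt5

variable {C : Type u} [Category.{v} C]

/-- `P` is projective with respect to the class of morphisms `R`. -/
def ProjectiveWrt (R : MorphismProperty C) (P : C) : Prop :=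
  ∀ ⦃A B : C⦄ (ρ : A ⟶ B), R ρ → ∀ u : P ⟶ B, ∃ v : P ⟶ A, v ≫ ρ = u

/-- `R` has enough projectives. -/
def EnoughProjectivesWrt (R : MorphismProperty C) : Prop :=
  ∀ X : C, ∃ (P : C) (ρ : P ⟶ X), R ρ ∧ ProjectiveWrt R P

/-- The class of effective epimorphisms. -/
def effEpis (C : Type u) [Category.{v} C] : MorphismProperty C :=
  fun _ _ f => EffectiveEpi f

theorem stmt5 [HasPullbacks C] (hproj : EnoughProjectivesWrt (effEpis C))
    {X Y Z : C} (f : X ⟶ Y) (g : Z ⟶ Y) [EffectiveEpi f] :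
    Epi (pullback.snd f g) := by
  obtain ⟨P, ρ, hρ, hP⟩ := hproj Z
  have : EffectiveEpi ρ := hρ
  obtain ⟨v, hv⟩ := hP f ‹EffectiveEpi f› (ρ ≫ g)
  exact epi_of_epi_fac (pullback.lift_snd v ρ hv)

end Stmt5
end

section
/- Let I be a small category in which idempotents split (I is idempotent complete). A presheaf F : Iᵒᵖ ⥤ Type is projective (in the sense that it lifts against all epimorphisms of presheaves) if and only if F is isomorphic to a coproduct of representable presheaves, i.e. there exists an indexing type J and objects X_j of I for j ∈ J with F ≅ ∐_{j ∈ J} yoneda(X_j). Without the assumption of idempotent completeness, F is projective if and only if F is a retract of a coproduct of representable presheaves. -/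
open CategoryTheory Limits

universe u

namespace Stmt8

/-- `F` is a retract of `G` (there are maps `i : F ⟶ G` and `r : G ⟶ F` with `i ≫ r = 𝟙 F`). -/
def IsRetractOf {C : Type*} [Category C] (F G : C) : Prop :=
  ∃ (i : F ⟶ G) (r : G ⟶ F), i ≫ r = 𝟙 F

open Opposite

variable {I : Type u} [SmallCategory I]

/-- The explicit model `c ↦ Σ j, (c ⟶ X j)` of the coproduct of the representables `X j`. -/
def sigmaYoneda {J : Type u} (X : J → I) : Iᵒᵖ ⥤ Type u where
  obj c := Σ j, (c.unop ⟶ X j)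
  map g := ↾fun x => ⟨x.1, g.unop ≫ x.2⟩

/-- The element of `sigmaYoneda X` given by a morphism to some `X j`. -/
def sigmaYonedaMk {J : Type u} {X : J → I} {c : Iᵒᵖ} (j : J) (f : c.unop ⟶ X j) :
    (sigmaYoneda X).obj c :=
  ⟨j, f⟩

section sigmaYoneda

variable {J : Type u} {X : J → I} {F : Iᵒᵖ ⥤ Type u}

theorem exists_eq_sigmaYonedaMk {c : Iᵒᵖ} (x : (sigmaYoneda X).obj c) :
    ∃ (j : J) (f : c.unop ⟶ X j), x = sigmaYonedaMk j f :=
  ⟨x.1, x.2, rfl⟩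

theorem sigmaYonedaMk_fst_eq {c : Iᵒᵖ} {j k : J} {f : c.unop ⟶ X j} {g : c.unop ⟶ X k}
    (h : (sigmaYonedaMk j f : (sigmaYoneda X).obj c) = sigmaYonedaMk k g) : j = k :=
  (Sigma.mk.inj h).1

theorem sigmaYonedaMk_injective {c : Iᵒᵖ} (j : J) :
    Function.Injective (sigmaYonedaMk j : (c.unop ⟶ X j) → (sigmaYoneda X).obj c) :=
  fun _ _ h => eq_of_heq (Sigma.mk.inj h).2

@[simp]
theorem sigmaYoneda_map_mk {c d : Iᵒᵖ} (g : c ⟶ d) (j : J) (f : c.unop ⟶ X j) :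
    (sigmaYoneda X).map g (sigmaYonedaMk j f) = sigmaYonedaMk j (g.unop ≫ f) :=
  rfl

theorem app_sigmaYonedaMk (φ : sigmaYoneda X ⟶ F) {c : Iᵒᵖ} (j : J) (f : c.unop ⟶ X j) :
    φ.app c (sigmaYonedaMk j f) = F.map f.op (φ.app (op (X j)) (sigmaYonedaMk j (𝟙 (X j)))) := by
  rw [← NatTrans.naturality_apply, sigmaYoneda_map_mk]
  simp

@[ext]
theorem sigmaYoneda_hom_ext {φ ψ : sigmaYoneda X ⟶ F}
    (h : ∀ j, φ.app (op (X j)) (sigmaYonedaMk j (𝟙 (X j))) =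
      ψ.app (op (X j)) (sigmaYonedaMk j (𝟙 (X j)))) : φ = ψ := by
  ext c x
  obtain ⟨j, f, rfl⟩ := exists_eq_sigmaYonedaMk x
  exact (app_sigmaYonedaMk φ j f).trans
    ((congrArg (F.map f.op) (h j)).trans (app_sigmaYonedaMk ψ j f).symm)

/-- The morphism out of `sigmaYoneda X` determined by a family of elements. -/
def sigmaYonedaDesc (e : ∀ j, F.obj (op (X j))) : sigmaYoneda X ⟶ F where
  app c := ↾fun x => F.map x.2.op (e x.1)
  naturality c d g := by
    ext x
    exact Functor.map_comp_apply F x.2.op g (e x.1)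

@[simp]
theorem sigmaYonedaDesc_app_mk (e : ∀ j, F.obj (op (X j))) {c : Iᵒᵖ} (j : J)
    (f : c.unop ⟶ X j) : (sigmaYonedaDesc e).app c (sigmaYonedaMk j f) = F.map f.op (e j) :=
  rfl

variable (X)

/-- `sigmaYoneda X` is the coproduct of the representables `X j`. -/
noncomputable def sigmaYonedaIso : (∐ fun j => yoneda.obj (X j)) ≅ sigmaYoneda X where
  hom := Sigma.desc fun j => yonedaEquiv.symm (sigmaYonedaMk j (𝟙 (X j)))
  inv := sigmaYonedaDesc fun j => yonedaEquiv (Sigma.ι (fun j => yoneda.obj (X j)) j)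
  hom_inv_id := by
    refine Sigma.hom_ext _ _ fun j => ?_
    rw [Sigma.ι_desc_assoc, yonedaEquiv_symm_naturality_right, Category.comp_id,
      Equiv.symm_apply_eq, sigmaYonedaDesc_app_mk]
    simp
  inv_hom_id := by
    ext j
    simp only [NatTrans.comp_app, types_comp_apply, sigmaYonedaDesc_app_mk]
    rw [op_id, Functor.map_id_apply, ← yonedaEquiv_comp, Sigma.ι_desc, Equiv.apply_symm_apply]
    simp

theorem projective_sigmaYoneda : Projective (sigmaYoneda X) where
  factors {E B} φ ρ _ := by
    have hρ (c : Iᵒᵖ) : Function.Surjective (ρ.app c) :=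
      (epi_iff_surjective _).1 inferInstance
    choose e he using fun j => hρ _ (φ.app (op (X j)) (sigmaYonedaMk j (𝟙 (X j))))
    refine ⟨sigmaYonedaDesc e, ?_⟩
    ext j
    rw [← he, NatTrans.comp_app, types_comp_apply, sigmaYonedaDesc_app_mk, op_id,
      Functor.map_id_apply]

end sigmaYoneda

theorem projective_of_isRetractOf {C : Type*} [Category C] {F G : C} [Projective G]
    (h : IsRetractOf F G) : Projective F :=
  let ⟨i, r, hir⟩ := h
  Retract.projective ⟨i, r, hir⟩

theorem isRetractOf_congr_right {C : Type*} [Category C] {F G H : C} (e : G ≅ H) :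
    IsRetractOf F G ↔ IsRetractOf F H :=
  ⟨fun ⟨i, r, h⟩ => ⟨i ≫ e.hom, e.inv ≫ r, by simpa using h⟩,
    fun ⟨i, r, h⟩ => ⟨i ≫ e.inv, e.hom ≫ r, by simpa using h⟩⟩

/-- Every projective presheaf is a retract of the coproduct of representables indexed by its
elements. -/
theorem exists_isRetractOf_sigmaYoneda (F : Iᵒᵖ ⥤ Type u) [Projective F] :
    ∃ (J : Type u) (X : J → I), IsRetractOf F (sigmaYoneda X) := by
  let X : (Σ c : I, F.obj (op c)) → I := Sigma.fst
  let π : sigmaYoneda X ⟶ F := sigmaYonedaDesc fun x => x.2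
  have hπ : Epi π := by
    rw [NatTrans.epi_iff_epi_app]
    refine fun c => (epi_iff_surjective _).2 fun x => ⟨sigmaYonedaMk ⟨c.unop, x⟩ (𝟙 _), ?_⟩
    exact (sigmaYonedaDesc_app_mk _ _ _).trans (Functor.map_id_apply F c x)
  exact ⟨_, X, Projective.factorThru (𝟙 F) π, π, Projective.factorThru_comp _ _⟩

/-- If idempotents split, a retract of a coproduct of representables is again a coproduct of
representables. -/
theorem exists_iso_sigmaYoneda_of_isRetractOf [IsIdempotentComplete I] {F : Iᵒᵖ ⥤ Type u}
    {J : Type u} {X : J → I} (h : IsRetractOf F (sigmaYoneda X)) :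
    ∃ (K : Type u) (Y : K → I), Nonempty (F ≅ sigmaYoneda Y) := by
  obtain ⟨i, r, hir⟩ := h
  have hir' {c : Iᵒᵖ} (x : F.obj c) : r.app c (i.app c x) = x :=
    congrArg (fun φ => φ.app c x) hir
  let e (j : J) : F.obj (op (X j)) := r.app (op (X j)) (sigmaYonedaMk j (𝟙 (X j)))
  have hi {c : Iᵒᵖ} {d : I} (f : c.unop ⟶ d) (x : F.obj (op d)) {j : J} {g : d ⟶ X j}
      (hx : i.app (op d) x = sigmaYonedaMk j g) :
      i.app c (F.map f.op x) = sigmaYonedaMk j (f ≫ g) := by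
    rw [NatTrans.naturality_apply, hx, sigmaYoneda_map_mk]
    rfl
  have key {c : Iᵒᵖ} {x : F.obj c} {j : J} {f : c.unop ⟶ X j}
      (hx : i.app c x = sigmaYonedaMk j f) : F.map f.op (e j) = x := by
    rw [← hir' x, hx, app_sigmaYonedaMk]
  let K := {j : J // ∃ p : X j ⟶ X j, i.app (op (X j)) (e j) = sigmaYonedaMk j p}
  have split (k : K) : ∃ (Y : I) (s : Y ⟶ X k) (q : X k ⟶ Y),
      s ≫ q = 𝟙 Y ∧ i.app (op (X k)) (e k) = sigmaYonedaMk k.1 (q ≫ s) := by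
    obtain ⟨j, p, hp⟩ := k
    have hpp : p ≫ p = p := by
      have h := hi (c := op (X j)) p (e j) hp
      rw [key hp, hp] at h
      exact (sigmaYonedaMk_injective j h).symm
    obtain ⟨Y, s, q, hsq, hqs⟩ := IsIdempotentComplete.idempotents_split _ p hpp
    exact ⟨Y, s, q, hsq, by rw [hqs]; exact hp⟩
  choose Y s q hsq he using split
  let φ : sigmaYoneda Y ⟶ F := sigmaYonedaDesc fun k => F.map (s k).op (e k)
  have hφ {c : Iᵒᵖ} (k : K) (f : c.unop ⟶ Y k) :
      φ.app c (sigmaYonedaMk k f) = F.map (f ≫ s k).op (e k) := by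
    rw [op_comp, Functor.map_comp_apply, sigmaYonedaDesc_app_mk]
  have bij (c : Iᵒᵖ) : Function.Bijective (φ.app c) := by
    constructor
    · intro x x' h
      obtain ⟨k, f, rfl⟩ := exists_eq_sigmaYonedaMk x
      obtain ⟨k', f', rfl⟩ := exists_eq_sigmaYonedaMk x'
      rw [hφ, hφ] at h
      have h' := congrArg (i.app c) h
      rw [hi _ _ (he k), hi _ _ (he k')] at h'
      simp only [Category.assoc, reassoc_of% hsq] at h'
      obtain rfl : k = k' := Subtype.ext (sigmaYonedaMk_fst_eq h')
      have h₃ := congrArg (· ≫ q k) (sigmaYonedaMk_injective _ h')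
      simp only [Category.assoc, hsq, Category.comp_id] at h₃
      rw [h₃]
    · intro x
      obtain ⟨j, f, hx⟩ := exists_eq_sigmaYonedaMk (i.app c x)
      obtain ⟨l, p, hp⟩ := exists_eq_sigmaYonedaMk (i.app (op (X j)) (e j))
      have h := hi (c := c) f (e j) hp
      rw [key hx, hx] at h
      obtain rfl := sigmaYonedaMk_fst_eq h
      let k : K := ⟨j, p, hp⟩
      have hpk : p = q k ≫ s k := sigmaYonedaMk_injective j (hp.symm.trans (he k))
      have hf : f = f ≫ q k ≫ s k := hpk ▸ sigmaYonedaMk_injective j h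
      refine ⟨sigmaYonedaMk k (f ≫ q k), ?_⟩
      rw [hφ, Category.assoc, ← hf, key hx]
  have (c : Iᵒᵖ) : IsIso (φ.app c) := (isIso_iff_bijective _).2 (bij c)
  have : IsIso φ := NatIso.isIso_of_isIso_app φ
  exact ⟨K, Y, ⟨(asIso φ).symm⟩⟩

theorem stmt8 {I : Type u} [SmallCategory I] (F : Iᵒᵖ ⥤ Type u) :
    -- in general, `F` is projective iff it is a retract of a coproduct of representables
    (Projective F ↔ ∃ (J : Type u) (X : J → I),
      IsRetractOf F (∐ fun j => yoneda.obj (X j))) ∧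
    -- if idempotents split in `I`, `F` is projective iff it is a coproduct of representables
    (IsIdempotentComplete I →
      (Projective F ↔ ∃ (J : Type u) (X : J → I),
        Nonempty (F ≅ ∐ fun j => yoneda.obj (X j)))) := by
  have hproj {J : Type u} (X : J → I) : Projective (∐ fun j => yoneda.obj (X j)) :=
    Projective.of_iso (sigmaYonedaIso X).symm (projective_sigmaYoneda X)
  refine ⟨⟨fun _ => ?_, fun ⟨J, X, h⟩ => ?_⟩, fun _ => ⟨fun _ => ?_, fun ⟨J, X, ⟨e⟩⟩ => ?_⟩⟩
  · obtain ⟨J, X, h⟩ := exists_isRetractOf_sigmaYoneda F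
    exact ⟨J, X, (isRetractOf_congr_right (sigmaYonedaIso X)).2 h⟩
  · have := hproj X
    exact projective_of_isRetractOf h
  · obtain ⟨J, X, h⟩ := exists_isRetractOf_sigmaYoneda F
    obtain ⟨K, Y, ⟨e⟩⟩ := exists_iso_sigmaYoneda_of_isRetractOf h
    exact ⟨K, Y, ⟨e ≪≫ (sigmaYonedaIso Y).symm⟩⟩
  · exact Projective.of_iso e.symm (hproj X)

end Stmt8
end

section
/- Let C be a category with all small coproducts and let R be a class of morphisms of C that is closed under retracts in the arrow category, has enough projectives, and is right-saturated in the strong sense that for every family of morphisms g_j : Y_j → Z (j in a small index set) such that g_{j₀} lies in R for some index j₀, the induced morphism ∐_j Y_j → Z lies in R. Let I be a small category and let R^p be the class of natural transformations in the functor category C^I whose component at every object of I lies in R. Then R^p is closed under retracts in the arrow category, right-saturated in the same strong sense, and has enough projectives; consequently, the pair (L^p, R^p), where L^p is the class of morphisms of C^I with the left lifting property with respect to all of R^p, is a weak factorization system on C^I. -/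
open CategoryTheory Limits

universe w v u v' u'

namespace Stmt9

section Defs

variable {D : Type u'} [Category.{v'} D]

/-- `f` is a retract of `g` in the arrow category. -/
def RetractArrow {A B X Y : D} (f : A ⟶ B) (g : X ⟶ Y) : Prop :=
  ∃ (i : Arrow.mk f ⟶ Arrow.mk g) (r : Arrow.mk g ⟶ Arrow.mk f), i ≫ r = 𝟙 (Arrow.mk f)

/-- `R` is closed under retracts in the arrow category. -/
def RetractClosed (R : MorphismProperty D) : Prop :=
  ∀ ⦃A B X Y : D⦄ (f : A ⟶ B) (g : X ⟶ Y), RetractArrow f g → R g → R f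

/-- `P` is projective with respect to the class of morphisms `R`. -/
def ProjectiveWrt (R : MorphismProperty D) (P : D) : Prop :=
  ∀ ⦃A B : D⦄ (ρ : A ⟶ B), R ρ → ∀ u : P ⟶ B, ∃ v : P ⟶ A, v ≫ ρ = u

/-- `R` has enough projectives. -/
def EnoughProjectivesWrt (R : MorphismProperty D) : Prop :=
  ∀ X : D, ∃ (P : D) (ρ : P ⟶ X), R ρ ∧ ProjectiveWrt R P

/-- `R` is right-saturated in the strong sense: whenever one member `g j₀` of a small family
of morphisms `g j : Y j ⟶ Z` lies in `R`, the induced morphism `∐ Y ⟶ Z` lies in `R`. -/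
def StrongRightSaturated (R : MorphismProperty D) : Prop :=
  ∀ (J : Type w) (Y : J → D) [HasCoproduct Y] (Z : D) (g : ∀ j, Y j ⟶ Z) (j₀ : J),
    R (g j₀) → R (Sigma.desc g)

/-- The class of morphisms with the left lifting property with respect to all of `R`. -/
def llp (R : MorphismProperty D) : MorphismProperty D :=
  fun _ _ f => ∀ ⦃X Y : D⦄ (g : X ⟶ Y), R g → HasLiftingProperty f g

/-- `(L, R)` is a weak factorization system. -/
def IsWFS (L R : MorphismProperty D) : Prop :=
  (∀ ⦃A B X Y : D⦄ (l : A ⟶ B) (r : X ⟶ Y), L l → R r → HasLiftingProperty l r) ∧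
  (∀ ⦃X Y : D⦄ (f : X ⟶ Y), ∃ (Z : D) (l : X ⟶ Z) (r : Z ⟶ Y), L l ∧ R r ∧ l ≫ r = f) ∧
  (∀ ⦃A B : D⦄ (l : A ⟶ B), L l ↔ ∀ ⦃X Y : D⦄ (r : X ⟶ Y), R r → HasLiftingProperty l r) ∧
  (∀ ⦃X Y : D⦄ (r : X ⟶ Y), R r ↔ ∀ ⦃A B : D⦄ (l : A ⟶ B), L l → HasLiftingProperty l r)

end Defs

variable {C : Type u} [Category.{v} C]

/-- The pointwise extension of `R` to the functor category `C^I`. -/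
def pointwise (I : Type w) [SmallCategory I] (R : MorphismProperty C) :
    MorphismProperty (I ⥤ C) :=
  fun _ _ η => ∀ i : I, R (η.app i)

section WeakFactorizationSystem

variable {D : Type u'} [Category.{v'} D] {R : MorphismProperty D}

lemma RetractClosed.isStableUnderRetracts (hR : RetractClosed R) : R.IsStableUnderRetracts where
  of_retract h hg := hR _ _ ⟨h.i, h.r, h.retract⟩ hg

lemma ProjectiveWrt.of_adjunction {E : Type*} [Category E] {F : E ⥤ D} {G : D ⥤ E}
    (adj : F ⊣ G) {P : E} {S : MorphismProperty E} (hP : ProjectiveWrt S P)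
    (h : ∀ ⦃A B : D⦄ (ρ : A ⟶ B), R ρ → S (G.map ρ)) : ProjectiveWrt R (F.obj P) := by
  intro A B ρ hρ u
  obtain ⟨v, hv⟩ := hP (G.map ρ) (h ρ hρ) (adj.homEquiv _ _ u)
  refine ⟨(adj.homEquiv _ _).symm v, ?_⟩
  rw [← adj.homEquiv_naturality_right_symm, hv, Equiv.symm_apply_apply]

lemma ProjectiveWrt.sigma {J : Type*} (Y : J → D) [HasCoproduct Y]
    (hY : ∀ j, ProjectiveWrt R (Y j)) : ProjectiveWrt R (∐ Y) := by
  intro A B ρ hρ u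
  choose v hv using fun j => hY j ρ hρ (Sigma.ι Y j ≫ u)
  exact ⟨Sigma.desc v, Sigma.hom_ext _ _ fun j => by simp [hv]⟩

lemma llp_sigma_ι {J : Type*} (Y : J → D) [HasCoproduct Y] (j₀ : J)
    (hY : ∀ j, j ≠ j₀ → ProjectiveWrt R (Y j)) : llp R (Sigma.ι Y j₀) := by
  intro A B g hg
  refine ⟨fun {u t} sq => ?_⟩
  have key : ∀ j, ∃ v : Y j ⟶ A, v ≫ g = Sigma.ι Y j ≫ t ∧
      ∀ h : j₀ = j, eqToHom (congrArg Y h) ≫ v = u := by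
    intro j
    by_cases h : j = j₀
    · subst h
      exact ⟨u, sq.w, fun _ => by simp⟩
    · obtain ⟨v, hv⟩ := hY j h g hg (Sigma.ι Y j ≫ t)
      exact ⟨v, hv, fun h' => absurd h'.symm h⟩
  choose v hv hv₀ using key
  exact ⟨⟨⟨Sigma.desc v, by simpa using hv₀ j₀ rfl,
    Sigma.hom_ext _ _ fun j => by simp [hv]⟩⟩⟩

lemma hasFactorization_llp [HasCoproducts.{w} D] (hsat : StrongRightSaturated.{w} R)
    (hproj : EnoughProjectivesWrt R) : MorphismProperty.HasFactorization (llp R) R where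
  nonempty_mapFactorizationData {X Y} f := by
    obtain ⟨P, ρ, hρ, hP⟩ := hproj Y
    let Z : Option PUnit.{w + 1} → D := fun j => j.elim X fun _ => P
    let g : ∀ j, Z j ⟶ Y := fun j =>
      match j with
      | none => f
      | some _ => ρ
    refine ⟨⟨∐ Z, Sigma.ι Z none, Sigma.desc g, Sigma.ι_desc g none, ?_,
      hsat _ Z _ g (some ⟨⟩) hρ⟩⟩
    refine llp_sigma_ι Z none fun j hj => ?_
    match j, hj with
    | some _, _ => exact hP

lemma isWFS_llp [HasCoproducts.{w} D] (hret : RetractClosed R)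
    (hsat : StrongRightSaturated.{w} R) (hproj : EnoughProjectivesWrt R) :
    IsWFS (llp R) R := by
  have := hret.isStableUnderRetracts
  have := hasFactorization_llp hsat hproj
  have hrlp : (llp R).rlp = R :=
    MorphismProperty.rlp_eq_of_le_rlp_of_hasFactorization_of_isStableUnderRetracts
      fun _ _ r hr _ _ _ hl => hl r hr
  refine ⟨fun _ _ _ _ l r hl hr => hl r hr, fun _ _ f => ?_, fun _ _ _ => Iff.rfl,
    fun X Y r => ⟨fun hr _ _ l hl => hl r hr, fun h => ?_⟩⟩
  · let d := MorphismProperty.factorizationData (llp R) R f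
    exact ⟨d.Z, d.i, d.p, d.hi, d.hp, d.fac⟩
  · rw [← hrlp]
    exact fun _ _ l hl => h l hl

end WeakFactorizationSystem

section Pointwise

variable {R : MorphismProperty C} {I : Type w} [SmallCategory I]

lemma RetractClosed.pointwise (hret : RetractClosed R) : RetractClosed (pointwise I R) := by
  rintro A B X Y f g ⟨i, r, h⟩ hg k
  let e := ((evaluation I C).obj k).mapArrow
  exact hret _ _ ⟨e.map i, e.map r, (e.map_comp i r).symm.trans ((congrArg e.map h).trans (e.map_id _))⟩ (hg k)

lemma pointwise_sigma_desc [HasCoproducts.{w} C] (hret : RetractClosed R)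
    (hsat : StrongRightSaturated.{w} R) {J : Type w} (Y : J → I ⥤ C) [HasCoproduct Y]
    {Z : I ⥤ C} (g : ∀ j, Y j ⟶ Z) (h : ∀ i, ∃ j, R ((g j).app i)) :
    pointwise I R (Sigma.desc g) := by
  intro i
  obtain ⟨j, hj⟩ := h i
  have := hret.isStableUnderRetracts
  have hs := hsat J (fun j => ((evaluation I C).obj i).obj (Y j)) _
    (fun j => ((evaluation I C).obj i).map (g j)) j hj
  rw [← sigmaComparison_map_desc] at hs
  exact (R.cancel_left_of_respectsIso _ _).1 hs

lemma StrongRightSaturated.pointwise [HasCoproducts.{w} C] (hret : RetractClosed R)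
    (hsat : StrongRightSaturated.{w} R) : StrongRightSaturated.{w} (pointwise I R) :=
  fun _ Y _ _ g j₀ h => pointwise_sigma_desc hret hsat Y g fun i => ⟨j₀, h i⟩

lemma EnoughProjectivesWrt.pointwise [HasCoproducts.{w} C] (hret : RetractClosed R)
    (hsat : StrongRightSaturated.{w} R) (hproj : EnoughProjectivesWrt R) :
    EnoughProjectivesWrt (pointwise I R) := by
  intro X
  choose P ρ hρ hP using fun i => hproj (X.obj i)
  let F : I → I ⥤ C := fun i => (evaluationLeftAdjoint C i).obj (P i)
  let g : ∀ i, F i ⟶ X := fun i => ((evaluationAdjunctionRight C i).homEquiv _ _).symm (ρ i)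
  refine ⟨∐ F, Sigma.desc g, pointwise_sigma_desc hret hsat F g fun i => ⟨i, ?_⟩,
    ProjectiveWrt.sigma F fun i =>
      (hP i).of_adjunction (evaluationAdjunctionRight C i) fun _ _ _ h => h i⟩
  have hg : (g i).app i = Sigma.desc fun h : i ⟶ i => ρ i ≫ X.map h := by
    simp [g, evaluationAdjunctionRight]
    rfl
  rw [hg]
  exact hsat _ _ _ _ (𝟙 i) (by simpa using hρ i)

end Pointwise

theorem stmt9 [HasCoproducts.{w} C] (R : MorphismProperty C)
    (hret : RetractClosed R)
    (hsat : StrongRightSaturated.{w} R)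
    (hproj : EnoughProjectivesWrt R)
    (I : Type w) [SmallCategory I] :
    RetractClosed (pointwise I R) ∧
    StrongRightSaturated.{w} (pointwise I R) ∧
    EnoughProjectivesWrt (pointwise I R) ∧
    IsWFS (llp (pointwise I R)) (pointwise I R) := by
  have h₁ := hret.pointwise (I := I)
  have h₂ := hsat.pointwise (I := I) hret
  have h₃ := hproj.pointwise (I := I) hret hsat
  exact ⟨h₁, h₂, h₃, isWFS_llp h₁ h₂ h₃⟩

end Stmt9
end

section
/- Let C be a category with all small coproducts, let R be a class of morphisms of C, let I be a small category, and let i be an object of I. If P is an object of C that is projective with respect to R, then the functor i_! P : I ⥤ C given on objects by j ↦ ∐_{φ ∈ Hom_I(i, j)} P (the left Kan extension of P along the inclusion of the object i, with transition maps given by reindexing the coproducts) is projective with respect to the class of natural transformations in C^I whose component at every object of I lies in R. -/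
open CategoryTheory Limits

universe w v u

namespace Stmt10

variable {C : Type u} [Category.{v} C]

/-- `P` is projective with respect to the class of morphisms `R`. -/
def ProjectiveWrt {D : Type*} [Category D] (R : MorphismProperty D) (P : D) : Prop :=
  ∀ ⦃A B : D⦄ (ρ : A ⟶ B), R ρ → ∀ u : P ⟶ B, ∃ v : P ⟶ A, v ≫ ρ = u

/-- The pointwise extension of `R` to the functor category `C^I`. -/
def pointwise (I : Type w) [SmallCategory I] (R : MorphismProperty C) :
    MorphismProperty (I ⥤ C) :=
  fun _ _ η => ∀ i : I, R (η.app i)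

/-- The functor `i_! P : I ⥤ C`, given on objects by `j ↦ ∐_{φ : i ⟶ j} P`,
with transition maps given by reindexing the coproducts. -/
noncomputable def pointFunctor [HasCoproducts.{w} C] {I : Type w} [SmallCategory I]
    (i : I) (P : C) : I ⥤ C where
  obj j := ∐ fun _ : i ⟶ j => P
  map {j k} f := Sigma.desc fun φ => Sigma.ι (fun _ : i ⟶ k => P) (φ ≫ f)
  map_id j := by
    ext φ
    simp
  map_comp {j k l} f g := by
    ext φ
    simp

section

variable [HasCoproducts.{w} C] {I : Type w} [SmallCategory I] {i : I} {P : C}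

/-- The inclusion of the summand indexed by `φ : i ⟶ j` into `(pointFunctor i P).obj j`. -/
noncomputable def pointFunctorι (P : C) {j : I} (φ : i ⟶ j) : P ⟶ (pointFunctor i P).obj j :=
  Sigma.ι (fun _ : i ⟶ j => P) φ

lemma pointFunctorι_map {j k : I} (φ : i ⟶ j) (f : j ⟶ k) :
    pointFunctorι P φ ≫ (pointFunctor i P).map f = pointFunctorι P (φ ≫ f) :=
  Sigma.ι_desc _ _

lemma pointFunctor_hom_ext {j : I} {X : C} {g h : (pointFunctor i P).obj j ⟶ X}
    (w : ∀ φ : i ⟶ j, pointFunctorι P φ ≫ g = pointFunctorι P φ ≫ h) : g = h :=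
  Sigma.hom_ext _ _ w

/-- On the summand indexed by `φ`, a natural transformation out of `pointFunctor i P` is
determined by its restriction to the summand indexed by the identity of `i`. -/
lemma pointFunctorι_app {B : I ⥤ C} (u : pointFunctor i P ⟶ B) {j : I} (φ : i ⟶ j) :
    pointFunctorι P φ ≫ u.app j = (pointFunctorι P (𝟙 i) ≫ u.app i) ≫ B.map φ := by
  rw [Category.assoc, ← u.naturality, ← Category.assoc, pointFunctorι_map, Category.id_comp]

/-- The natural transformation out of `pointFunctor i P` corresponding to a morphism
`P ⟶ A.obj i`. -/
noncomputable def pointFunctorDesc {A : I ⥤ C} (v : P ⟶ A.obj i) : pointFunctor i P ⟶ A where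
  app j := Sigma.desc fun φ : i ⟶ j => v ≫ A.map φ
  naturality j k f := by
    dsimp [pointFunctor]
    ext φ
    simp

lemma pointFunctorι_desc_app {A : I ⥤ C} (v : P ⟶ A.obj i) {j : I} (φ : i ⟶ j) :
    pointFunctorι P φ ≫ (pointFunctorDesc v).app j = v ≫ A.map φ :=
  Sigma.ι_desc _ _

end

theorem stmt10 [HasCoproducts.{w} C] {I : Type w} [SmallCategory I]
    (R : MorphismProperty C) (i : I) (P : C) (hP : ProjectiveWrt R P) :
    ProjectiveWrt (pointwise I R) (pointFunctor i P) := by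
  intro A B ρ hρ u
  obtain ⟨v, hv⟩ := hP (ρ.app i) (hρ i) (pointFunctorι P (𝟙 i) ≫ u.app i)
  refine ⟨pointFunctorDesc v, NatTrans.ext (funext fun j => pointFunctor_hom_ext fun φ => ?_)⟩
  rw [pointFunctorι_app u φ, ← hv, NatTrans.comp_app, ← Category.assoc, pointFunctorι_desc_app,
    Category.assoc, ρ.naturality, Category.assoc]

end Stmt10
end

section
/- Let C be a finitary extensive category. Let a : A → X and b : B → X be morphisms each isomorphic in the arrow category to a coproduct inclusion inl : U → U ⨿ V, and let D := A ×_X B be their pullback. Then the pushout A ⨿_D B of the pullback projections D → A and D → B exists, and the canonical morphism A ⨿_D B → X induced by a and b is again isomorphic in the arrow category to a coproduct inclusion. -/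
open CategoryTheory Limits

universe v u

namespace Stmt17

variable {C : Type u} [Category.{v} C]

/-- `f` is a coproduct injection: it is isomorphic in the arrow category to some
coproduct inclusion `inl : U ⟶ U ⨿ V`. -/
def IsCoprodInclusion [HasBinaryCoproducts C] {A X : C} (f : A ⟶ X) : Prop :=
  ∃ (U V : C), Nonempty (Arrow.mk f ≅ Arrow.mk (coprod.inl : U ⟶ U ⨿ V))

theorem exists_desc_of_isColimit_binaryCofan {A V X T : C} {f : A ⟶ X} {v : V ⟶ X}
    (h : IsColimit (BinaryCofan.mk f v)) (x : A ⟶ T) (y : V ⟶ T) :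
    ∃ l : X ⟶ T, f ≫ l = x ∧ v ≫ l = y :=
  ⟨_, (BinaryCofan.IsColimit.desc' h x y).2⟩

theorem hom_ext_of_isColimit_binaryCofan {A V X T : C} {f : A ⟶ X} {v : V ⟶ X}
    (h : IsColimit (BinaryCofan.mk f v)) {l m : X ⟶ T} (h₁ : f ≫ l = f ≫ m)
    (h₂ : v ≫ l = v ≫ m) : l = m :=
  BinaryCofan.IsColimit.hom_ext h h₁ h₂

theorem nonempty_isColimit_binaryCofan_mk {A V X : C} {f : A ⟶ X} {v : V ⟶ X}
    (h : ∀ {T : C} (x : A ⟶ T) (y : V ⟶ T), ∃ l : X ⟶ T, f ≫ l = x ∧ v ≫ l = y)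
    (h' : ∀ {T : C} {l m : X ⟶ T}, f ≫ l = f ≫ m → v ≫ l = v ≫ m → l = m) :
    Nonempty (IsColimit (BinaryCofan.mk f v)) := by
  choose desc hd₁ hd₂ using @h
  exact ⟨BinaryCofan.IsColimit.mk _ desc hd₁ hd₂ fun x y m h₁ h₂ ↦
    h' (h₁.trans (hd₁ x y).symm) (h₂.trans (hd₂ x y).symm)⟩

theorem exists_iso_coprod_of_isColimit_binaryCofan [HasBinaryCoproducts C] {A V X : C}
    {f : A ⟶ X} {v : V ⟶ X} (h : IsColimit (BinaryCofan.mk f v)) :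
    ∃ r : X ≅ A ⨿ V, f ≫ r.hom = coprod.inl :=
  ⟨h.coconePointUniqueUpToIso (colimit.isColimit (pair A V)),
    h.comp_coconePointUniqueUpToIso_hom (colimit.isColimit (pair A V)) ⟨.left⟩⟩

theorem isCoprodInclusion_iff [HasBinaryCoproducts C] {A X : C} (f : A ⟶ X) :
    IsCoprodInclusion f ↔ ∃ (V : C) (v : V ⟶ X), Nonempty (IsColimit (BinaryCofan.mk f v)) := by
  constructor
  · rintro ⟨U, V, ⟨e⟩⟩
    let l : A ≅ U := Arrow.leftFunc.mapIso e
    let r : X ≅ U ⨿ V := Arrow.rightFunc.mapIso e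
    have w : l.hom ≫ coprod.inl = f ≫ r.hom := e.hom.w
    have w' : f = l.hom ≫ coprod.inl ≫ r.inv := by
      rw [reassoc_of% w, r.hom_inv_id, Category.comp_id]
    have h : IsColimit (BinaryCofan.mk (coprod.inl ≫ r.inv) (coprod.inr ≫ r.inv)) :=
      (coprodIsCoprod U V).ofIsoColimit (BinaryCofan.ext r.symm rfl rfl)
    refine ⟨V, coprod.inr ≫ r.inv, ⟨?_⟩⟩
    rw [w']
    exact BinaryCofan.isColimitCompLeftIso _ l.hom h
  · rintro ⟨V, v, ⟨h⟩⟩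
    obtain ⟨r, hr⟩ := exists_iso_coprod_of_isColimit_binaryCofan h
    exact ⟨A, V, ⟨Arrow.isoMk (Iso.refl A) r (by simp [hr])⟩⟩

theorem hasPullback_of_isColimit_binaryCofan [HasBinaryCoproducts C] [HasPullbacksOfInclusions C]
    {A V X Z : C} {f : A ⟶ X} {v : V ⟶ X} (h : IsColimit (BinaryCofan.mk f v)) (g : Z ⟶ X) :
    HasPullback g f := by
  obtain ⟨r, w⟩ := exists_iso_coprod_of_isColimit_binaryCofan h
  have hp : IsPullback (pullback.fst (g ≫ r.hom) coprod.inl)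
      (pullback.snd (g ≫ r.hom) (coprod.inl : A ⟶ A ⨿ V)) g f := by
    refine (IsPullback.of_hasPullback (g ≫ r.hom) coprod.inl).of_iso
      (Iso.refl _) (Iso.refl _) (Iso.refl _) r.symm ?_ ?_ ?_ ?_ <;> simp [← w]
  exact hp.hasPullback

theorem nonempty_isColimit_of_isPullback_binaryCofan [FinitaryExtensive C]
    {A V X Y P Q : C} {f : A ⟶ X} {v : V ⟶ X} (h : IsColimit (BinaryCofan.mk f v)) {g : Y ⟶ X}
    {p : P ⟶ Y} {p' : P ⟶ A} {q : Q ⟶ Y} {q' : Q ⟶ V}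
    (hp : IsPullback p p' g f) (hq : IsPullback q q' g v) :
    Nonempty (IsColimit (BinaryCofan.mk p q)) :=
  ((BinaryCofan.isVanKampen_iff _).1 (FinitaryExtensive.vanKampen _ h)
    (BinaryCofan.mk p q) p' q' g hp.w.symm hq.w.symm).2 ⟨hp, hq⟩

/-- Pushing out a coproduct inclusion `D ⟶ A` with complement `E` along `D ⟶ B` gives `B ⨿ E`. -/
theorem isPushout_of_isColimit_binaryCofan {A B D E P : C} {d : D ⟶ A} {e : E ⟶ A} {t : D ⟶ B}
    {i : B ⟶ P} {j : A ⟶ P} (hA : IsColimit (BinaryCofan.mk d e))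
    (hP : IsColimit (BinaryCofan.mk i (e ≫ j))) (w : d ≫ j = t ≫ i) : IsPushout d t j i := by
  have key (s : PushoutCocone d t) := exists_desc_of_isColimit_binaryCofan hP s.inr (e ≫ s.inl)
  choose desc hd₁ hd₂ using key
  refine ⟨⟨w⟩, ⟨PushoutCocone.IsColimit.mk w desc (fun s ↦ ?_) hd₁ (fun s m h₁ h₂ ↦ ?_)⟩⟩
  · refine hom_ext_of_isColimit_binaryCofan hA ?_ (by simpa using hd₂ s)
    rw [reassoc_of% w, hd₁, s.condition]
  · refine hom_ext_of_isColimit_binaryCofan hP (by rw [h₂, hd₁]) ?_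
    rw [hd₂, Category.assoc, h₁]

/-- If `X = B ⨿ V` and `V = E ⨿ F`, then `B ⨿ E ⟶ X` is a coproduct inclusion with
complement `F`. -/
theorem nonempty_isColimit_desc_binaryCofan {B V E F X P : C} {b : B ⟶ X} {v : V ⟶ X}
    {e : E ⟶ V} {f : F ⟶ V} {i : B ⟶ P} {k : E ⟶ P} {m : P ⟶ X}
    (hX : IsColimit (BinaryCofan.mk b v)) (hV : IsColimit (BinaryCofan.mk e f))
    (hP : IsColimit (BinaryCofan.mk i k)) (hi : i ≫ m = b) (hk : k ≫ m = e ≫ v) :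
    Nonempty (IsColimit (BinaryCofan.mk m (f ≫ v))) := by
  refine nonempty_isColimit_binaryCofan_mk (fun {T} x y ↦ ?_) (fun {T l n} h₁ h₂ ↦ ?_)
  · obtain ⟨p, p₁, p₂⟩ := exists_desc_of_isColimit_binaryCofan hV (k ≫ x) y
    obtain ⟨q, q₁, q₂⟩ := exists_desc_of_isColimit_binaryCofan hX (i ≫ x) p
    refine ⟨q, hom_ext_of_isColimit_binaryCofan hP ?_ ?_, ?_⟩
    · rw [reassoc_of% hi, q₁]
    · rw [reassoc_of% hk, q₂, p₁]
    · rw [Category.assoc, q₂, p₂]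
  · refine hom_ext_of_isColimit_binaryCofan hX ?_ (hom_ext_of_isColimit_binaryCofan hV ?_ ?_)
    · simp only [← hi, Category.assoc, h₁]
    · simp only [← reassoc_of% hk, h₁]
    · simpa using h₂

theorem stmt17 [FinitaryExtensive C] {A B X : C} (a : A ⟶ X) (b : B ⟶ X)
    (ha : IsCoprodInclusion a) (hb : IsCoprodInclusion b) :
    ∃ (h₁ : HasPullback a b),
      haveI := h₁
      ∃ (h₂ : HasPushout (pullback.fst a b) (pullback.snd a b)),
        haveI := h₂
        IsCoprodInclusion (pushout.desc a b pullback.condition) := by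
  obtain ⟨W, w, ⟨hA⟩⟩ := (isCoprodInclusion_iff a).1 ha
  obtain ⟨V, v, ⟨hB⟩⟩ := (isCoprodInclusion_iff b).1 hb
  have hB' : IsColimit (BinaryCofan.mk v b) := BinaryCofan.isColimitFlip hB
  have hA' : IsColimit (BinaryCofan.mk w a) := BinaryCofan.isColimitFlip hA
  have h₁ : HasPullback a b := hasPullback_of_isColimit_binaryCofan hB a
  have := hasPullback_of_isColimit_binaryCofan hB' a
  have := hasPullback_of_isColimit_binaryCofan hA' v
  have hE : IsPullback (pullback.fst a v) (pullback.snd a v) a v := .of_hasPullback a v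
  obtain ⟨hDE⟩ := nonempty_isColimit_of_isPullback_binaryCofan hB
    (IsPullback.of_hasPullback a b) hE
  obtain ⟨hEF⟩ := nonempty_isColimit_of_isPullback_binaryCofan hA hE.flip
    (IsPullback.of_hasPullback v w)
  obtain ⟨j, hj₁, hj₂⟩ := exists_desc_of_isColimit_binaryCofan hDE
    (pullback.snd a b ≫ (coprod.inl : B ⟶ B ⨿ pullback a v)) coprod.inr
  have hP : IsPushout (pullback.fst a b) (pullback.snd a b) j coprod.inl := by
    refine isPushout_of_isColimit_binaryCofan hDE ?_ hj₁
    rw [hj₂]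
    exact coprodIsCoprod _ _
  have h₂ := hP.hasPushout
  refine ⟨h₁, h₂, (isCoprodInclusion_iff _).2 ⟨_, pullback.fst v w ≫ v, ?_⟩⟩
  have hr : coprod.inr ≫ hP.isoPushout.hom =
      pullback.fst a v ≫ pushout.inl (pullback.fst a b) (pullback.snd a b) := by
    rw [← hj₂, Category.assoc, hP.inl_isoPushout_hom]
  have hQ : IsColimit (BinaryCofan.mk (pushout.inr (pullback.fst a b) (pullback.snd a b))
      (pullback.fst a v ≫ pushout.inl (pullback.fst a b) (pullback.snd a b))) :=
    (coprodIsCoprod B (pullback a v)).ofIsoColimit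
      (BinaryCofan.ext hP.isoPushout hP.inr_isoPushout_hom hr)
  exact nonempty_isColimit_desc_binaryCofan hB hEF hQ (pushout.inr_desc _ _ _)
    (by rw [Category.assoc, pushout.inl_desc, pullback.condition])

end Stmt17
end
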